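/- Let P and Q be probability distributions on finite sets with V(P) > 0 and H(Q) > 0, and let b ∈ ℝ. If A : ℝ → ℝ is continuously differentiable, monotone increasing, and satisfies G_P(x) ≤ A(x) ≤ 1 for all x ∈ ℝ, then liminf_{n→∞} F^D(P^n → Q^{⌊(H(P)/H(Q))n + b√n⌋}) ≥ ∫_ℝ √(A'(x)·N_{P,Q,b}(x)) dx. -/

import Mathlib

open MeasureTheory Filter

namespace RNG

variable {α β : Type*}

/-- `P` is a probability distribution on the finite set `α`. -/
def IsProb [Fintype α] (P : α → ℝ) : Prop :=
  (∀ x, 0 ≤ P x) ∧ ∑ x, P x = 1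

open Classical in
/-- Pushforward distribution `W(P)(y) = ∑_{x : W x = y} P x`. -/
noncomputable def push [Fintype α] (W : α → β) (P : α → ℝ) : β → ℝ :=
  fun y => ∑ x, if W x = y then P x else 0

/-- Fidelity (Bhattacharyya coefficient) between distributions on the same finite set. -/
noncomputable def fid [Fintype β] (R S : β → ℝ) : ℝ :=
  ∑ y, Real.sqrt (R y * S y)

/-- Sum of the `l` largest values of `P`, i.e. the `l`-th partial sum of the
decreasing rearrangement of `P` (padded with zeros). -/
noncomputable def topSum [Fintype α] (P : α → ℝ) (l : ℕ) : ℝ :=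
  sSup {s : ℝ | ∃ A : Finset α, A.card ≤ l ∧ s = ∑ x ∈ A, P x}

/-- Majorization `P ≺ P'` (the distributions may live on different finite sets). -/
def Maj [Fintype α] [Fintype β] (P : α → ℝ) (P' : β → ℝ) : Prop :=
  ∀ l : ℕ, topSum P l ≤ topSum P' l

/-- Maximal fidelity under deterministic transformations,
`F^D(P → Q) = max {F(W(P), Q) | W : α → β}`. -/
noncomputable def FD [Fintype α] [Fintype β] (P : α → ℝ) (Q : β → ℝ) : ℝ :=
  sSup {r : ℝ | ∃ W : α → β, r = fid (push W P) Q}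

/-- Maximal fidelity under the majorization condition,
`F^M(P → Q) = max {F(P', Q) | P ≺ P', P'` a distribution on the target set`}`. -/
noncomputable def FM [Fintype α] [Fintype β] (P : α → ℝ) (Q : β → ℝ) : ℝ :=
  sSup {r : ℝ | ∃ P' : β → ℝ, IsProb P' ∧ Maj P P' ∧ r = fid P' Q}

/-- Shannon entropy (natural logarithm). -/
noncomputable def H [Fintype α] (P : α → ℝ) : ℝ := ∑ x, -(P x * Real.log (P x))

/-- Varentropy `V(P)` (natural logarithm). -/
noncomputable def V [Fintype α] (P : α → ℝ) : ℝ :=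
  ∑ x, P x * (-Real.log (P x) - H P) ^ 2

/-- Shannon entropy, base-2 logarithm. -/
noncomputable def H2 [Fintype α] (P : α → ℝ) : ℝ := ∑ x, -(P x * Real.logb 2 (P x))

/-- Varentropy, base-2 logarithm. -/
noncomputable def V2 [Fintype α] (P : α → ℝ) : ℝ :=
  ∑ x, P x * (-Real.logb 2 (P x) - H2 P) ^ 2

/-- The `n`-fold i.i.d. product distribution `P^n`. -/
noncomputable def iid [Fintype α] (P : α → ℝ) (n : ℕ) : (Fin n → α) → ℝ :=
  fun f => ∏ i, P (f i)

/-- The uniform distribution on a two-element set. -/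
noncomputable def U2 : Fin 2 → ℝ := fun _ => 1 / 2

/-- Density of the normal distribution `N(m, v)`. -/
noncomputable def normalPDF (m v t : ℝ) : ℝ :=
  (Real.sqrt (2 * Real.pi * v))⁻¹ * Real.exp (-(t - m) ^ 2 / (2 * v))

/-- Standard normal cumulative distribution function `G`. -/
noncomputable def stdG (x : ℝ) : ℝ := ∫ t in Set.Iic x, normalPDF 0 1 t

/-- Density `N_P` of `N(0, V(P))`. -/
noncomputable def NP [Fintype α] (P : α → ℝ) (x : ℝ) : ℝ := normalPDF 0 (V P) x

/-- Density `N_{P,Q,b}` of `N(H(Q)b, (H(P)/H(Q))·V(Q))`. -/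
noncomputable def NPQ [Fintype α] [Fintype β] (P : α → ℝ) (Q : β → ℝ) (b x : ℝ) : ℝ :=
  normalPDF (H Q * b) (H P / H Q * V Q) x

/-- Cdf `G_P(x) = G(x/√V(P))`. -/
noncomputable def GP [Fintype α] (P : α → ℝ) (x : ℝ) : ℝ := stdG (x / Real.sqrt (V P))

/-- Cdf `G_{P,Q,b}(x) = G(√(H(Q)/(H(P)V(Q)))·(x − H(Q)b))`. -/
noncomputable def GPQ [Fintype α] [Fintype β] (P : α → ℝ) (Q : β → ℝ) (b x : ℝ) : ℝ :=
  stdG (Real.sqrt (H Q / (H P * V Q)) * (x - H Q * b))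

/-- `I_{P,Q,b}(x) = ∫_{−∞}^x √(N_P(t) N_{P,Q,b}(t)) dt`. -/
noncomputable def IPQ [Fintype α] [Fintype β] (P : α → ℝ) (Q : β → ℝ) (b x : ℝ) : ℝ :=
  ∫ t in Set.Iic x, Real.sqrt (NP P t * NPQ P Q b t)

/-- `I_{P,Q,b}(∞) = ∫_ℝ √(N_P(t) N_{P,Q,b}(t)) dt`. -/
noncomputable def IPQinf [Fintype α] [Fintype β] (P : α → ℝ) (Q : β → ℝ) (b : ℝ) : ℝ :=
  ∫ t : ℝ, Real.sqrt (NP P t * NPQ P Q b t)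

/-- `L^D_n(P,Q|ν)`: the maximal `L` with `F^D(P^n → Q^L) ≥ ν`. -/
noncomputable def LD [Fintype α] [Fintype β] (P : α → ℝ) (Q : β → ℝ) (ν : ℝ) (n : ℕ) : ℕ :=
  sSup {L : ℕ | ν ≤ FD (iid P n) (iid Q L)}

/-- The optimal second order rate `R^D_2(P,Q|ν)`. -/
noncomputable def RD2 [Fintype α] [Fintype β] (P : α → ℝ) (Q : β → ℝ) (ν : ℝ) : ℝ :=
  sSup {b : ℝ | ∃ c : ℝ, ν ≤ c ∧
    Tendsto (fun n : ℕ =>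
      FD (iid P n) (iid Q (⌊H P / H Q * n + b * Real.sqrt n⌋₊))) atTop (nhds c)}

section Greedy

open Finset

/-- A finite set whose weights are at most `e` has a subset whose weight lies within `e` below any
prescribed value that does not exceed the total weight. -/
lemma exists_subset_sum_near {p : α → ℝ} {e d : ℝ} (hd : 0 ≤ d) (he : 0 ≤ e) (U : Finset α)
    (hU : ∀ x ∈ U, p x ≤ e) (hdU : d ≤ ∑ x ∈ U, p x) :
    ∃ B ⊆ U, d - e ≤ ∑ x ∈ B, p x ∧ ∑ x ∈ B, p x ≤ d := by
  classical
  induction U using Finset.induction_on with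
  | empty =>
    refine ⟨∅, subset_rfl, ?_, by simpa using hd⟩
    simp only [sum_empty] at hdU ⊢
    linarith
  | insert a U ha ih =>
    by_cases h : d ≤ ∑ x ∈ U, p x
    · obtain ⟨B, hB, h1, h2⟩ := ih (fun x hx => hU x (mem_insert_of_mem hx)) h
      exact ⟨B, hB.trans (subset_insert _ _), h1, h2⟩
    · refine ⟨U, subset_insert _ _, ?_, by linarith⟩
      rw [sum_insert ha] at hdU
      linarith [hU a (mem_insert_self _ _)]

open Classical in
/-- Greedy packing: the demands `d y` of the targets `y ∈ s` can be met up to `e (f y)` by disjoint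
sets of sources of weight at most `e (f y)`, provided that for every target the sources light enough
for it cover the demands of all targets which come later in the order given by `f`. -/
lemma exists_disjoint_packing [Fintype α] {p : α → ℝ} {f : β → ℕ}
    {e : ℕ → ℝ} {d : β → ℝ} (hp : ∀ x, 0 ≤ p x) (he : ∀ i, 0 ≤ e i) (s : Finset β) (hd : ∀ y ∈ s, 0 ≤ d y)
    (hcond : ∀ y ∈ s, ∑ z ∈ s with f y ≤ f z, d z ≤ ∑ x with p x ≤ e (f y), p x) :
    ∃ B : β → Finset α, (s : Set β).PairwiseDisjoint B ∧
      ∀ y ∈ s, d y - e (f y) ≤ ∑ x ∈ B y, p x ∧ ∑ x ∈ B y, p x ≤ d y := by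
  induction s using Finset.induction_on_min_value f with
  | empty => exact ⟨fun _ => ∅, by simp, by simp⟩
  | insert a s ha hmin ih =>
    obtain ⟨B, hB, hBd⟩ := ih (fun y hy => hd y (mem_insert_of_mem hy)) (by
      intro y hy
      refine le_trans ?_ (hcond y (mem_insert_of_mem hy))
      refine sum_le_sum_of_subset_of_nonneg (filter_subset_filter _ (subset_insert _ _)) ?_
      intro z hz _
      exact hd z (mem_filter.1 hz).1)
    set U : Finset α := univ.filter (fun x => p x ≤ e (f a)) \ s.biUnion B with hU
    have hused : ∑ x ∈ s.biUnion B, p x ≤ ∑ y ∈ s, d y := by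
      rw [sum_biUnion hB]
      exact sum_le_sum fun y hy => (hBd y hy).2
    have hall : ∑ z ∈ insert a s with f a ≤ f z, d z = d a + ∑ y ∈ s, d y := by
      rw [filter_true_of_mem, sum_insert ha]
      intro z hz
      rcases mem_insert.1 hz with rfl | hz
      · exact le_rfl
      · exact hmin z hz
    have hdU : d a ≤ ∑ x ∈ U, p x := by
      have h1 := hcond a (mem_insert_self _ _)
      rw [hall] at h1
      have h2 : ∑ x with p x ≤ e (f a), p x ≤ ∑ x ∈ U, p x + ∑ x ∈ s.biUnion B, p x := by
        rw [← sum_union sdiff_disjoint, sdiff_union_self_eq_union]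
        exact sum_le_sum_of_subset_of_nonneg subset_union_left fun x _ _ => hp x
      linarith
    obtain ⟨C, hCU, hC1, hC2⟩ := exists_subset_sum_near (hd a (mem_insert_self _ _)) (he (f a)) U
      (fun x hx => by simpa using (mem_sdiff.1 hx).1) hdU
    have hne : ∀ y ∈ s, y ≠ a := fun y hy h => ha (h ▸ hy)
    have hdisj : ∀ y ∈ s, Disjoint (B y) C := by
      intro y hy
      rw [Finset.disjoint_left]
      intro x hx hxC
      exact (mem_sdiff.1 (hCU hxC)).2 (mem_biUnion.2 ⟨y, hy, hx⟩)
    refine ⟨Function.update B a C, ?_, ?_⟩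
    · intro y hy z hz hyz
      rcases mem_insert.1 (mem_coe.1 hy) with rfl | hy' <;>
        rcases mem_insert.1 (mem_coe.1 hz) with rfl | hz'
      · exact absurd rfl hyz
      · simpa [Function.onFun, hne z hz'] using (hdisj z hz').symm
      · simpa [Function.onFun, hne y hy'] using hdisj y hy'
      · simpa [Function.onFun, hne y hy', hne z hz'] using hB hy' hz' hyz
    · intro y hy
      rcases mem_insert.1 hy with rfl | hy'
      · simpa using ⟨by linarith, hC2⟩
      · simpa [hne y hy'] using hBd y hy'

end Greedy

lemma push_nonneg [Fintype α] {p : α → ℝ} (hp : ∀ x, 0 ≤ p x) (W : α → β) (y : β) :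
    0 ≤ push W p y :=
  Finset.sum_nonneg fun x _ => by split_ifs <;> simp [hp]

lemma sum_push [Fintype α] [Fintype β] (p : α → ℝ) (W : α → β) :
    ∑ y, push W p y = ∑ x, p x := by
  classical
  simp only [push]
  rw [Finset.sum_comm]
  simp

lemma IsProb.fid_push_le_one [Fintype α] [Fintype β] {p : α → ℝ} {q : β → ℝ} (hp : IsProb p)
    (hq : IsProb q) (W : α → β) : fid (push W p) q ≤ 1 := by
  have h : ∀ y, Real.sqrt (push W p y * q y) ≤ (push W p y + q y) / 2 := by
    intro y
    have h0 := push_nonneg hp.1 W y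
    have h1 := hq.1 y
    rw [Real.sqrt_le_left (by positivity)]
    nlinarith [sq_nonneg (push W p y - q y)]
  calc fid (push W p) q ≤ ∑ y, (push W p y + q y) / 2 := Finset.sum_le_sum fun y _ => h y
    _ = 1 := by
      rw [← Finset.sum_div, Finset.sum_add_distrib, sum_push, hp.2, hq.2]
      norm_num

lemma FD_nonneg [Fintype α] [Fintype β] (p : α → ℝ) (q : β → ℝ) : 0 ≤ FD p q := by
  refine Real.sSup_nonneg ?_
  rintro r ⟨W, rfl⟩
  exact Finset.sum_nonneg fun _ _ => Real.sqrt_nonneg _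

lemma IsProb.FD_le_one [Fintype α] [Fintype β] {p : α → ℝ} {q : β → ℝ} (hp : IsProb p)
    (hq : IsProb q) : FD p q ≤ 1 := by
  refine Real.sSup_le ?_ zero_le_one
  rintro r ⟨W, rfl⟩
  exact hp.fid_push_le_one hq W

lemma IsProb.fid_push_le_FD [Fintype α] [Fintype β] {p : α → ℝ} {q : β → ℝ} (hp : IsProb p)
    (hq : IsProb q) (W : α → β) : fid (push W p) q ≤ FD p q := by
  refine le_csSup ⟨1, ?_⟩ ⟨W, rfl⟩
  rintro r ⟨W, rfl⟩
  exact hp.fid_push_le_one hq W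

lemma IsProb.isProb_iid [Fintype α] {P : α → ℝ} (hP : IsProb P) (n : ℕ) : IsProb (iid P n) := by
  refine ⟨fun x => Finset.prod_nonneg fun i _ => hP.1 _, ?_⟩
  classical
  have := Finset.prod_univ_sum (fun _ : Fin n => (Finset.univ : Finset α)) (fun _ x => P x)
  simp only [hP.2, Finset.prod_const_one, Fintype.piFinset_univ] at this
  exact this.symm

open Classical Finset in
/-- Lower bound on the maximal fidelity from a partition of part of the target into blocks
`f ⁻¹' {i}`, where a block of mass `m i` receives mass about `ρ i * m i`. -/
lemma IsProb.sum_blocks_le_FD [Fintype α] [Fintype β] {p : α → ℝ} {q : β → ℝ} (hp : IsProb p)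
    (hq : IsProb q) {k : ℕ} {f : β → ℕ} {T : Finset β} (hT : ∀ y ∈ T, f y < k) {ρ e : ℕ → ℝ}
    {η : ℝ} (he : ∀ i, 0 ≤ e i) (hρ : ∀ i, 0 ≤ ρ i)
    (hcond : ∀ i < k, ∑ j ∈ Ico i k, ρ j * ∑ y ∈ T with f y = j, q y ≤ ∑ x with p x ≤ e i, p x)
    (hsmall : ∀ y ∈ T, 0 < ρ (f y) → e (f y) ≤ η * (ρ (f y) * q y)) :
    ∑ i ∈ range k, Real.sqrt ((1 - η) * ρ i) * ∑ y ∈ T with f y = i, q y ≤ FD p q := by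
  obtain ⟨B, hB, hBd⟩ := exists_disjoint_packing (p := p) (f := f) (e := e)
    (d := fun y => ρ (f y) * q y) hp.1 he T (fun y _ => mul_nonneg (hρ _) (hq.1 _)) (by
      intro y hy
      refine le_trans (le_of_eq ?_) (hcond (f y) (hT y hy))
      rw [← sum_fiberwise_of_maps_to (t := Ico (f y) k) (g := f)]
      · refine sum_congr rfl fun j hj => ?_
        rw [mul_sum, filter_filter]
        refine sum_congr ?_ fun z hz => ?_
        · ext z
          simp only [mem_filter, and_congr_right_iff]
          intro _
          constructor
          · exact fun h => h.2
          · rintro rfl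
            exact ⟨(mem_Ico.1 hj).1, rfl⟩
        · rw [(mem_filter.1 hz).2]
      · intro z hz
        exact mem_Ico.2 ⟨(mem_filter.1 hz).2, hT z (mem_filter.1 hz).1⟩)
  have hne : Nonempty β := by
    by_contra h
    rw [not_nonempty_iff] at h
    simpa using hq.2
  obtain ⟨y₀⟩ := hne
  set W : α → β := fun x => if h : ∃ y ∈ T, x ∈ B y then h.choose else y₀ with hW
  have hWB : ∀ y ∈ T, ∀ x ∈ B y, W x = y := by
    intro y hy x hx
    have h : ∃ y ∈ T, x ∈ B y := ⟨y, hy, hx⟩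
    simp only [hW, dif_pos h]
    by_contra hne
    exact Finset.disjoint_left.1 (hB h.choose_spec.1 hy hne) h.choose_spec.2 hx
  have hpush : ∀ y ∈ T, ∑ x ∈ B y, p x ≤ push W p y := by
    intro y hy
    rw [push, ← sum_filter]
    refine sum_le_sum_of_subset_of_nonneg (fun x hx => ?_) fun x _ _ => hp.1 x
    simpa using hWB y hy x hx
  refine le_trans ?_ (hp.fid_push_le_FD hq W)
  have hle : ∀ y ∈ T, Real.sqrt ((1 - η) * ρ (f y)) * q y ≤ Real.sqrt (push W p y * q y) := by
    intro y hy
    rcases (hρ (f y)).eq_or_lt with h0 | h0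
    · simp [← h0]
    · have h1 := (hBd y hy).1
      have h2 := hsmall y hy h0
      have h3 := hpush y hy
      refine Real.le_sqrt_of_sq_le ?_
      have hq0 := hq.1 y
      have hkey : (1 - η) * ρ (f y) * q y ≤ push W p y := by linarith
      rcases le_or_gt 0 ((1 - η) * ρ (f y)) with h4 | h4
      · rw [mul_pow, Real.sq_sqrt h4]
        nlinarith
      · rw [Real.sqrt_eq_zero_of_nonpos h4.le]
        have := push_nonneg hp.1 W y
        simp only [zero_mul, ne_eq, OfNat.ofNat_ne_zero, not_false_eq_true, zero_pow]
        positivity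
  calc ∑ i ∈ range k, Real.sqrt ((1 - η) * ρ i) * ∑ y ∈ T with f y = i, q y
      = ∑ y ∈ T, Real.sqrt ((1 - η) * ρ (f y)) * q y := by
        rw [← sum_fiberwise_of_maps_to (t := range k) (g := f) fun y hy => mem_range.2 (hT y hy)]
        refine sum_congr rfl fun j _ => ?_
        rw [mul_sum]
        refine sum_congr rfl fun z hz => ?_
        rw [(mem_filter.1 hz).2]
    _ ≤ ∑ y ∈ T, Real.sqrt (push W p y * q y) := sum_le_sum hle
    _ ≤ fid (push W p) q :=
        sum_le_sum_of_subset_of_nonneg (subset_univ _) fun _ _ _ => Real.sqrt_nonneg _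

section Limit

open ProbabilityTheory Topology

/-- The measure on a finite type with the given point masses. -/
noncomputable def pointMeasure [Fintype α] [MeasurableSpace α] (P : α → ℝ) : Measure α :=
  ∑ x, ENNReal.ofReal (P x) • Measure.dirac x

lemma pointMeasure_singleton [Fintype α] [MeasurableSpace α] [MeasurableSingletonClass α]
    (P : α → ℝ) (x : α) : pointMeasure P {x} = ENNReal.ofReal (P x) := by
  classical
  simp [pointMeasure, Measure.finsetSum_apply, Set.indicator_apply]

lemma IsProb.isProbabilityMeasure_pointMeasure [Fintype α] [MeasurableSpace α] {P : α → ℝ}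
    (hP : IsProb P) : IsProbabilityMeasure (pointMeasure P) := by
  refine ⟨?_⟩
  simp only [pointMeasure, Measure.finsetSum_apply, Measure.smul_apply, measure_univ, smul_eq_mul,
    mul_one]
  rw [← ENNReal.ofReal_sum_of_nonneg fun x _ => hP.1 x, hP.2, ENNReal.ofReal_one]

lemma IsProb.integral_pointMeasure [Fintype α] [MeasurableSpace α] [MeasurableSingletonClass α]
    {P : α → ℝ} (hP : IsProb P) (g : α → ℝ) : ∫ x, g x ∂(pointMeasure P) = ∑ x, P x * g x := by
  have := hP.isProbabilityMeasure_pointMeasure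
  rw [integral_fintype .of_finite]
  simp [measureReal_def, pointMeasure_singleton, hP.1]

lemma IsProb.infinitePi_pointMeasure_apply [Fintype α] [MeasurableSpace α]
    [MeasurableSingletonClass α] {P : α → ℝ} (hP : IsProb P) (n : ℕ) (E : Set (Fin n → α)) :
    ((Measure.infinitePi fun _ : ℕ => pointMeasure P) {ω | (fun i : Fin n => ω i) ∈ E}).toReal =
      ∑ x, E.indicator (iid P n) x := by
  classical
  have := hP.isProbabilityMeasure_pointMeasure
  have hmap := Measure.map_infinitePi_infinitePi_of_inj (P := fun _ : ℕ => pointMeasure P)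
    (f := fun i : Fin n => (i : ℕ)) Fin.val_injective
  have hE : MeasurableSet E := E.toFinite.measurableSet
  have h1 : (Measure.infinitePi fun _ : ℕ => pointMeasure P) {ω | (fun i : Fin n => ω i) ∈ E} =
      (Measure.infinitePi fun _ : Fin n => pointMeasure P) E := by
    rw [← hmap, Measure.map_apply (by fun_prop) hE]
    rfl
  rw [h1, ← measureReal_def, ← E.toFinite.coe_toFinset, ← sum_measureReal_singleton,
    ← Finset.sum_indicator_subset _ (Finset.subset_univ _)]
  refine Finset.sum_congr rfl fun x _ => ?_
  congr 1
  ext x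
  simp [measureReal_def, pointMeasure_singleton, iid, ENNReal.toReal_prod, hP.1]

/-- Central limit theorem for the information content of an i.i.d. source, along a sequence of block
lengths and up to a convergent affine change of coordinates. -/
lemma IsProb.tendsto_iid_information [Fintype α] {P : α → ℝ} (hP : IsProb P) (hV : 0 < V P)
    {L : ℕ → ℕ} (hL : Tendsto L atTop atTop) {a d : ℕ → ℝ} {a₀ d₀ : ℝ} (ha₀ : a₀ ≠ 0)
    (ha : Tendsto a atTop (𝓝 a₀)) (hd : Tendsto d atTop (𝓝 d₀)) {S : Set ℝ}
    (hS : MeasurableSet S) (hfr : volume (frontier S) = 0) :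
    Tendsto (fun n => ∑ x : Fin (L n) → α, Set.indicator
      {x | a n * ((Real.sqrt (L n))⁻¹ * (∑ i, -Real.log (P (x i)) - L n * H P)) + d n ∈ S}
        (iid P (L n)) x) atTop (𝓝 (∫ t in S, normalPDF d₀ (a₀ ^ 2 * V P) t)) := by
  let _ : MeasurableSpace α := ⊤
  have := hP.isProbabilityMeasure_pointMeasure
  set μ := Measure.infinitePi fun _ : ℕ => pointMeasure P with hμ
  set X : ℕ → (ℕ → α) → ℝ := fun i ω => -Real.log (P (ω i)) with hX
  have hXm : ∀ i, Measurable (X i) := fun i =>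
    (measurable_of_finite (fun x : α => -Real.log (P x))).comp (measurable_pi_apply i)
  have hindep : iIndepFun X μ :=
    iIndepFun_infinitePi (P := fun _ : ℕ => pointMeasure P) (X := fun _ x => -Real.log (P x))
      fun i => measurable_of_finite _
  have hmap : ∀ i, μ.map (fun ω => ω i) = pointMeasure P := fun i =>
    Measure.infinitePi_map_eval (fun _ : ℕ => pointMeasure P) i
  have hid : ∀ i, IdentDistrib (X i) (X 0) μ μ := by
    intro i
    have h0 : IdentDistrib (fun ω : ℕ → α => ω i) (fun ω : ℕ → α => ω 0) μ μ :=
      ⟨(measurable_pi_apply i).aemeasurable, (measurable_pi_apply 0).aemeasurable,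
        by rw [hmap, hmap]⟩
    exact h0.comp (u := fun x : α => -Real.log (P x)) (measurable_of_finite _)
  have hint : ∀ g : α → ℝ, ∫ ω, g (ω 0) ∂μ = ∑ x, P x * g x := by
    intro g
    rw [← hP.integral_pointMeasure, ← hmap 0, integral_map (measurable_pi_apply 0).aemeasurable]
    exact (measurable_of_finite g).aestronglyMeasurable
  have hmean : μ[X 0] = H P := by
    rw [hX]
    simp only
    rw [hint (fun x => -Real.log (P x))]
    simp [H]
  have hvar : Var[X 0; μ] = V P := by
    rw [variance_eq_integral (hXm 0).aemeasurable, hmean]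
    exact hint (fun x => (-Real.log (P x) - H P) ^ 2)
  have hmem : MemLp (X 0) 2 μ := by
    have h0 : MemLp (fun x : α => -Real.log (P x)) 2 (pointMeasure P) := .of_discrete
    rw [← hmap 0] at h0
    exact h0.comp_of_map (measurable_pi_apply 0).aemeasurable
  have hclt := tendstoInDistribution_inv_sqrt_mul_sum_sub
    (P' := gaussianReal 0 Var[X 0; μ].toNNReal) (Y := id) ⟨by fun_prop, by simp⟩ hmem hindep hid
  rw [hmean, hvar] at hclt
  have hclt2 : TendstoInDistribution
      (fun (n : ℕ) ω => (√(L n : ℝ))⁻¹ * (∑ k ∈ Finset.range (L n), X k ω - L n * H P)) atTop id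
      (fun _ => μ) (gaussianReal 0 (V P).toNNReal) :=
    ⟨fun n => hclt.forall_aemeasurable (L n), hclt.aemeasurable_limit, hclt.tendsto.comp hL⟩
  have hconst : ∀ {u : ℕ → ℝ × ℝ} {c : ℝ × ℝ}, Tendsto u atTop (𝓝 c) →
      TendstoInMeasure μ (fun n _ => u n) atTop (fun _ => c) := by
    intro u c hu
    exact tendstoInMeasure_of_tendsto_ae (fun n => aestronglyMeasurable_const)
      (.of_forall fun _ => hu)
  have hfin := hclt2.continuous_comp_prodMk_of_tendstoInMeasure_const
    (g := fun z : ℝ × (ℝ × ℝ) => z.2.1 * z.1 + z.2.2) (by fun_prop)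
    (hconst (ha.prodMk_nhds hd)) (fun _ => aemeasurable_const)
  have hv0 : (Real.toNNReal (a₀ ^ 2 * V P)) ≠ 0 := by
    simp only [ne_eq, Real.toNNReal_eq_zero, not_le]
    positivity
  have hlaw : (gaussianReal 0 (V P).toNNReal).map (fun t => a₀ * id t + d₀) =
      gaussianReal d₀ (Real.toNNReal (a₀ ^ 2 * V P)) := by
    have : (fun t : ℝ => a₀ * id t + d₀) = (fun t => t + d₀) ∘ (fun t => a₀ * t) := rfl
    rw [this, ← Measure.map_map (by fun_prop) (by fun_prop), gaussianReal_map_const_mul,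
      gaussianReal_map_add_const, mul_zero, zero_add]
    congr 1
    ext
    simp [hV.le, mul_nonneg, sq_nonneg]
  have hport := ProbabilityMeasure.tendsto_measure_of_null_frontier_of_tendsto' hfin.tendsto
    (E := S) (by
      simp only [ProbabilityMeasure.coe_mk]
      rw [hlaw]
      exact gaussianReal_absolutelyContinuous _ hv0 hfr)
  simp only [ProbabilityMeasure.coe_mk] at hport
  rw [hlaw, gaussianReal_apply_eq_integral _ hv0] at hport
  have hreal := (ENNReal.tendsto_toReal ENNReal.ofReal_ne_top).comp hport
  rw [ENNReal.toReal_ofReal (integral_nonneg fun t => gaussianPDFReal_nonneg _ _ _)] at hreal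
  convert hreal using 2 with n
  · simp only [Function.comp_apply]
    rw [Measure.map_apply_of_aemeasurable (hfin.forall_aemeasurable n) hS,
      ← hP.infinitePi_pointMeasure_apply]
    congr 2
    ext ω
    simp [hX, Finset.sum_range]
  · congr 1
    ext t
    rw [gaussianPDFReal, normalPDF, Real.coe_toNNReal _ (by positivity)]

lemma normalPDF_eq_gaussianPDFReal {m v : ℝ} (hv : 0 ≤ v) :
    normalPDF m v = gaussianPDFReal m v.toNNReal := by
  ext t
  rw [gaussianPDFReal, normalPDF, Real.coe_toNNReal _ hv]

lemma normalPDF_pos {m v : ℝ} (hv : 0 < v) (t : ℝ) : 0 < normalPDF m v t := by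
  unfold normalPDF
  positivity

lemma continuous_normalPDF (m v : ℝ) : Continuous (normalPDF m v) := by
  unfold normalPDF
  fun_prop

lemma integrable_normalPDF {m v : ℝ} (hv : 0 ≤ v) : Integrable (normalPDF m v) := by
  rw [normalPDF_eq_gaussianPDFReal hv]
  exact integrable_gaussianPDFReal _ _

lemma integral_Ioi_normalPDF (u : ℝ) : ∫ t in Set.Ioi u, normalPDF 0 1 t = 1 - stdG u := by
  have hi : Integrable (normalPDF 0 1) := integrable_normalPDF zero_le_one
  have h := intervalIntegral.integral_Iic_add_Ioi (b := u) hi.integrableOn hi.integrableOn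
  have h1 : ∫ t, normalPDF 0 1 t = 1 := by
    rw [normalPDF_eq_gaussianPDFReal zero_le_one]
    exact integral_gaussianPDFReal_eq_one _ (by simp)
  rw [h1] at h
  rw [stdG]
  linarith

lemma stdG_lt_one (u : ℝ) : stdG u < 1 := by
  have hi : Integrable (normalPDF 0 1) := integrable_normalPDF zero_le_one
  have h1 : 0 < ∫ t in u..(u + 1), normalPDF 0 1 t :=
    intervalIntegral.intervalIntegral_pos_of_pos (hi.intervalIntegrable)
      (fun t => normalPDF_pos one_pos t) (by linarith)
  rw [intervalIntegral.integral_of_le (by linarith)] at h1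
  have h2 : ∫ t in Set.Ioc u (u + 1), normalPDF 0 1 t ≤ ∫ t in Set.Ioi u, normalPDF 0 1 t :=
    setIntegral_mono_set hi.integrableOn (.of_forall fun t => (normalPDF_pos one_pos t).le)
      (.of_forall fun t ht => ht.1)
  rw [integral_Ioi_normalPDF] at h2
  linarith

lemma iid_eq_exp [Fintype α] {P : α → ℝ} (hP : IsProb P) {n : ℕ} {x : Fin n → α}
    (hx : iid P n x ≠ 0) : iid P n x = Real.exp (-∑ i, -Real.log (P (x i))) := by
  have h : ∀ i, P (x i) ≠ 0 := fun i => (Finset.prod_ne_zero_iff.1 hx) i (Finset.mem_univ i)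
  rw [Finset.sum_neg_distrib, neg_neg, Real.exp_sum, iid]
  exact Finset.prod_congr rfl fun i _ => (Real.exp_log ((hP.1 _).lt_of_ne' (h i))).symm

open Classical Finset in
/-- Asymptotically, the sequences of probability at most `exp (-(n H(P) + √n t))` carry at least the
mass `1 - G_P(t)`. -/
lemma IsProb.eventually_le_sum_light [Fintype α] {P : α → ℝ} (hP : IsProb P) (hV : 0 < V P)
    {t c : ℝ} (hc : c < 1 - GP P t) :
    ∀ᶠ n : ℕ in atTop, c ≤ ∑ x with iid P n x ≤ Real.exp (-(H P * n + Real.sqrt n * t)),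
      iid P n x := by
  have hsV : 0 < Real.sqrt (V P) := Real.sqrt_pos.2 hV
  have h := hP.tendsto_iid_information hV tendsto_id (a := fun _ => (Real.sqrt (V P))⁻¹)
    (d := fun _ => 0) (by positivity) tendsto_const_nhds tendsto_const_nhds
    (S := Set.Ioi (t / Real.sqrt (V P))) measurableSet_Ioi (by simp)
  rw [inv_pow, Real.sq_sqrt hV.le, inv_mul_cancel₀ hV.ne', integral_Ioi_normalPDF] at h
  filter_upwards [h.eventually_const_lt hc, eventually_gt_atTop 0] with n hn hn0
  refine hn.le.trans ?_
  rw [sum_filter]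
  refine sum_le_sum fun x _ => ?_
  have hsn : 0 < Real.sqrt n := Real.sqrt_pos.2 (by exact_mod_cast hn0)
  have h0 : 0 ≤ iid P n x := (hP.isProb_iid n).1 x
  by_cases hx : iid P n x = 0
  · simp [Set.indicator_apply, hx]
  rw [Set.indicator_apply]
  split_ifs with h1 h2 h2
  · exact le_rfl
  · refine absurd ?_ h2
    rw [iid_eq_exp hP hx]
    refine Real.exp_le_exp.2 (neg_le_neg ?_)
    simp only [id, Set.mem_ofPred_eq, add_zero, Set.mem_Ioi, div_eq_inv_mul] at h1
    have h3 := lt_of_mul_lt_mul_left h1 (by positivity)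
    rw [lt_inv_mul_iff₀ hsn] at h3
    linarith
  · exact h0
  · exact le_rfl

/-- The lengths `⌊c n + b √n⌋` are `c n + b √n + o(√n)`. -/
lemma tendsto_floor_sub_div_sqrt {c : ℝ} (hc : 0 < c) (b : ℝ) :
    Tendsto (fun n : ℕ => ((⌊c * n + b * Real.sqrt n⌋₊ : ℝ) - c * n) / Real.sqrt n) atTop
      (𝓝 b) := by
  have hs : Tendsto (fun n : ℕ => Real.sqrt n) atTop atTop :=
    Real.tendsto_sqrt_atTop.comp tendsto_natCast_atTop_atTop
  have hz : Tendsto (fun n : ℕ => b - 1 / Real.sqrt n) atTop (𝓝 b) := by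
    simpa using tendsto_const_nhds.sub (hs.inv_tendsto_atTop)
  refine tendsto_of_tendsto_of_tendsto_of_le_of_le' hz tendsto_const_nhds ?_ ?_
  · filter_upwards [eventually_gt_atTop 0] with n hn
    have hsn : 0 < Real.sqrt n := Real.sqrt_pos.2 (by exact_mod_cast hn)
    rw [le_div_iff₀ hsn, sub_mul, div_mul_cancel₀ _ hsn.ne']
    linarith [Nat.lt_floor_add_one (c * n + b * Real.sqrt n)]
  · filter_upwards [eventually_gt_atTop 0, hs.eventually_ge_atTop (-b / c)] with n hn hb
    have hsn : 0 < Real.sqrt n := Real.sqrt_pos.2 (by exact_mod_cast hn)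
    rw [div_le_iff₀ hsn]
    have hnn : (n : ℝ) = Real.sqrt n * Real.sqrt n := (Real.mul_self_sqrt (by positivity)).symm
    have h0 : 0 ≤ c * n + b * Real.sqrt n := by
      rw [div_le_iff₀ hc] at hb
      nlinarith
    linarith [Nat.floor_le h0]

lemma tendsto_floor_div {c : ℝ} (hc : 0 < c) (b : ℝ) :
    Tendsto (fun n : ℕ => (⌊c * n + b * Real.sqrt n⌋₊ : ℝ) / n) atTop (𝓝 c) := by
  have hs : Tendsto (fun n : ℕ => Real.sqrt n) atTop atTop :=
    Real.tendsto_sqrt_atTop.comp tendsto_natCast_atTop_atTop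
  have h := ((tendsto_floor_sub_div_sqrt hc b).mul hs.inv_tendsto_atTop).const_add c
  rw [mul_zero, add_zero] at h
  refine h.congr' ?_
  filter_upwards [eventually_gt_atTop 0] with n hn
  have hn' : (0 : ℝ) < n := by exact_mod_cast hn
  have hsn : 0 < Real.sqrt n := Real.sqrt_pos.2 hn'
  simp only [Pi.inv_apply]
  rw [← div_eq_mul_inv, div_div, Real.mul_self_sqrt hn'.le]
  field_simp
  ring

lemma tendsto_floor_atTop {c : ℝ} (hc : 0 < c) (b : ℝ) :
    Tendsto (fun n : ℕ => ⌊c * n + b * Real.sqrt n⌋₊) atTop atTop := by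
  have h := (tendsto_floor_div hc b).pos_mul_atTop hc tendsto_natCast_atTop_atTop
  refine (tendsto_natCast_atTop_iff (R := ℝ)).1 (h.congr' ?_)
  filter_upwards [eventually_gt_atTop 0] with n hn
  have hn' : (n : ℝ) ≠ 0 := by exact_mod_cast hn.ne'
  field_simp

open Classical Finset in
/-- Limiting mass of the target sequences whose information content lies in a window of width of
order `√n` around `n H(P)`. -/
lemma IsProb.tendsto_sum_window [Fintype β] {Q : β → ℝ} (hQ : IsProb Q) (hV : 0 < V Q)
    (hH : 0 < H Q) {s : ℝ} (hs : 0 < s) (b u v : ℝ) {L : ℕ → ℕ}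
    (hL : L = fun n : ℕ => ⌊s / H Q * n + b * Real.sqrt n⌋₊) :
    Tendsto (fun n : ℕ => ∑ y : Fin (L n) → β with
      iid Q (L n) y ≠ 0 ∧ (∑ i, -Real.log (Q (y i)) - s * n) / Real.sqrt n ∈ Set.Ioc u v,
        iid Q (L n) y) atTop (𝓝 (∫ t in Set.Ioc u v, normalPDF (H Q * b) (s / H Q * V Q) t)) := by
  have hc : 0 < s / H Q := by positivity
  have hLt : Tendsto L atTop atTop := hL ▸ tendsto_floor_atTop hc b
  have ha : Tendsto (fun n : ℕ => Real.sqrt ((L n : ℝ) / n)) atTop (𝓝 (Real.sqrt (s / H Q))) := by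
    subst hL
    exact (Real.continuous_sqrt.tendsto _).comp (tendsto_floor_div hc b)
  have hd : Tendsto (fun n : ℕ => H Q * (((L n : ℝ) - s / H Q * n) / Real.sqrt n)) atTop
      (𝓝 (H Q * b)) := by
    subst hL
    exact (tendsto_floor_sub_div_sqrt hc b).const_mul _
  have h := hQ.tendsto_iid_information hV hLt (Real.sqrt_pos.2 hc).ne' ha hd (S := Set.Ioc u v)
    measurableSet_Ioc (by
      rcases lt_or_ge u v with huv | huv
      · rw [frontier_Ioc huv]
        exact (Set.toFinite _).measure_zero _
      · simp [Set.Ioc_eq_empty (not_lt.2 huv)])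
  rw [Real.sq_sqrt hc.le] at h
  refine h.congr' ?_
  filter_upwards [eventually_gt_atTop 0, hLt.eventually_gt_atTop 0] with n hn hLn
  have hn' : (0 : ℝ) < n := by exact_mod_cast hn
  have hLn' : (0 : ℝ) < L n := by exact_mod_cast hLn
  rw [sum_filter]
  refine sum_congr rfl fun y _ => ?_
  have hsn : 0 < Real.sqrt n := Real.sqrt_pos.2 hn'
  have hsL : 0 < Real.sqrt (L n) := Real.sqrt_pos.2 hLn'
  have hkey : Real.sqrt ((L n : ℝ) / n) *
      ((Real.sqrt (L n))⁻¹ * (∑ i, -Real.log (Q (y i)) - L n * H Q)) +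
      H Q * (((L n : ℝ) - s / H Q * n) / Real.sqrt n) =
      (∑ i, -Real.log (Q (y i)) - s * n) / Real.sqrt n := by
    rw [Real.sqrt_div hLn'.le]
    field_simp
    ring
  simp only [Set.indicator_apply, Set.mem_ofPred_eq, hkey]
  by_cases h0 : iid Q (L n) y = 0 <;> simp [h0]

end Limit

section Blocks

open Topology

lemma H_pos_of_V_pos [Fintype α] {P : α → ℝ} (hP : IsProb P) (hV : 0 < V P) : 0 < H P := by
  have h1 : ∀ x ∈ Finset.univ, 0 ≤ -(P x * Real.log (P x)) := by
    intro x hx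
    have h1 : P x ≤ 1 := hP.2 ▸ Finset.single_le_sum (fun x _ => hP.1 x) hx
    exact neg_nonneg.2 (mul_nonpos_of_nonneg_of_nonpos (hP.1 x) (Real.log_nonpos (hP.1 x) h1))
  refine (Finset.sum_nonneg h1).lt_of_ne' fun h0 => hV.ne' ?_
  refine Finset.sum_eq_zero fun x hx => ?_
  have h3 : P x * Real.log (P x) = 0 := by
    simpa using (Finset.sum_eq_zero_iff_of_nonneg h1).1 h0 x hx
  rw [show H P = 0 from h0, sub_zero, neg_sq, sq, ← mul_assoc, h3, zero_mul]

open Classical Finset in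
/-- The maximal fidelity asymptotically reaches the Riemann-type sum of the blocks of width `h`, with
a shift of `A` by two blocks. -/
lemma eventually_le_FD_of_lt_sum_blocks [Fintype α] [Fintype β] {P : α → ℝ} {Q : β → ℝ}
    (hP : IsProb P) (hQ : IsProb Q) (hVP : 0 < V P) (hVQ : 0 < V Q) (hHQ : 0 < H Q) (b : ℝ)
    {A : ℝ → ℝ} (hmono : Monotone A) (hlb : ∀ x, GP P x ≤ A x) (hub : ∀ x, A x ≤ 1)
    (x₀ : ℝ) {h : ℝ} (hh : 0 < h) (k : ℕ) {η : ℝ} (hη : 0 < η) (hη1 : η < 1) {c : ℝ}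
    (hc : c < (1 - η) * ∑ i ∈ range k, Real.sqrt
      ((A (x₀ + (i + 1 : ℕ) * h + 2 * h) - A (x₀ + i * h + 2 * h)) *
        ∫ t in Set.Ioc (x₀ + i * h) (x₀ + (i + 1 : ℕ) * h), NPQ P Q b t)) :
    ∀ᶠ n : ℕ in atTop, c ≤ FD (iid P n) (iid Q ⌊H P / H Q * n + b * Real.sqrt n⌋₊) := by
  have hHP := H_pos_of_V_pos hP hVP
  have hη' : 0 < 1 - η := by linarith
  set x : ℕ → ℝ := fun i => x₀ + i * h with hx
  have hxs : ∀ i, x (i + 1) = x i + h := fun i => by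
    simp only [hx]
    push_cast
    ring
  set B : ℕ → ℝ := fun i => A (x i + 2 * h) with hBdef
  set N : ℕ → ℝ := fun i => ∫ t in Set.Ioc (x i) (x (i + 1)), NPQ P Q b t with hN
  have hvar : 0 < H P / H Q * V Q := by positivity
  have hNpos : ∀ i, 0 < N i := by
    intro i
    have h1 : 0 < ∫ t in (x i)..(x (i + 1)), NPQ P Q b t :=
      intervalIntegral.intervalIntegral_pos_of_pos
        ((continuous_normalPDF _ _).intervalIntegrable _ _) (fun t => normalPDF_pos hvar t)
        (by rw [hxs]; linarith)
    rwa [intervalIntegral.integral_of_le (by rw [hxs]; linarith)] at h1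
  have hBmono : ∀ i, 0 ≤ B (i + 1) - B i := fun i =>
    sub_nonneg.2 (hmono (by rw [hxs]; linarith))
  set ρ : ℕ → ℝ := fun i => (1 - η) * (B (i + 1) - B i) / N i with hρ
  have hρ0 : ∀ i, 0 ≤ ρ i := fun i =>
    div_nonneg (mul_nonneg hη'.le (hBmono i)) (hNpos i).le
  set e : ℕ → ℕ → ℝ := fun n i => Real.exp (-(H P * n + Real.sqrt n * (x i + 2 * h))) with he
  set L : ℕ → ℕ := fun n => ⌊H P / H Q * n + b * Real.sqrt n⌋₊ with hL
  set pos : (n : ℕ) → (Fin (L n) → β) → ℝ :=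
    fun n y => (∑ i, -Real.log (Q (y i)) - H P * n) / Real.sqrt n with hpos
  set f : (n : ℕ) → (Fin (L n) → β) → ℕ := fun n y => ⌈(pos n y - x₀) / h⌉₊ - 1 with hf
  set T : (n : ℕ) → Finset (Fin (L n) → β) :=
    fun n => {y | iid Q (L n) y ≠ 0 ∧ pos n y ∈ Set.Ioc x₀ (x k)} with hT
  set m : ℕ → ℕ → ℝ := fun n i => ∑ y ∈ T n with f n y = i, iid Q (L n) y with hm
  have hfT : ∀ n, ∀ y ∈ T n, f n y < k ∧ x (f n y) < pos n y ∧ pos n y ≤ x (f n y + 1) := by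
    intro n y hy
    have hy' := (mem_filter.1 hy).2.2
    have h0 : 0 < (pos n y - x₀) / h := div_pos (by linarith [hy'.1]) hh
    have h1 : 0 < ⌈(pos n y - x₀) / h⌉₊ := Nat.ceil_pos.2 h0
    have h2 : ⌈(pos n y - x₀) / h⌉₊ ≤ k := by
      rw [Nat.ceil_le, div_le_iff₀ hh]
      have := hy'.2
      simp only [hx] at this
      linarith
    have h3 : f n y + 1 = ⌈(pos n y - x₀) / h⌉₊ := Nat.sub_add_cancel h1
    refine ⟨by lia, ?_, ?_⟩
    · have h4 : f n y < ⌈(pos n y - x₀) / h⌉₊ := by lia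
      rw [Nat.lt_ceil, lt_div_iff₀ hh] at h4
      simp only [hx]
      linarith
    · have h4 := Nat.le_ceil ((pos n y - x₀) / h)
      rw [← h3, div_le_iff₀ hh] at h4
      simp only [hx]
      linarith
  have hxmono : StrictMono x := strictMono_nat_of_lt_succ fun i => by rw [hxs]; linarith
  have hmN : ∀ i < k, Tendsto (fun n => m n i) atTop (𝓝 (N i)) := by
    intro i hi
    refine (hQ.tendsto_sum_window hVQ hHQ hHP b (x i) (x (i + 1)) hL).congr fun n => ?_
    refine sum_congr ?_ fun _ _ => rfl
    ext y
    simp only [mem_filter, mem_univ, true_and]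
    constructor
    · rintro ⟨h1, h2⟩
      have hyT : y ∈ T n := by
        simp only [hT, mem_filter, mem_univ, true_and]
        refine ⟨h1, lt_of_le_of_lt ?_ h2.1, h2.2.trans (hxmono.monotone hi)⟩
        simp only [hx]
        have : 0 ≤ (i : ℝ) * h := by positivity
        linarith
      refine ⟨hyT, ?_⟩
      obtain ⟨-, h3, h4⟩ := hfT n y hyT
      have h5 := hxmono.lt_iff_lt.1 (h3.trans_le h2.2)
      have h6 := hxmono.lt_iff_lt.1 (h2.1.trans_le h4)
      lia
    · rintro ⟨h1, rfl⟩
      exact ⟨(mem_filter.1 h1).2.1, (hfT n y h1).2.1, (hfT n y h1).2.2⟩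
  have hcond : ∀ᶠ n in atTop, ∀ i ∈ range k, ∑ j ∈ Ico i k, ρ j * m n j ≤
      ∑ z with iid P n z ≤ e n i, iid P n z := by
    rw [eventually_all_finset]
    intro i hi
    have hi := mem_range.1 hi
    have hlim : Tendsto (fun n => ∑ j ∈ Ico i k, ρ j * m n j) atTop
        (𝓝 (∑ j ∈ Ico i k, ρ j * N j)) :=
      tendsto_finsetSum _ fun j hj => (hmN j (mem_Ico.1 hj).2).const_mul _
    have hsum : ∑ j ∈ Ico i k, ρ j * N j = (1 - η) * (B k - B i) := by
      rw [← sum_Ico_sub B hi.le, mul_sum]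
      refine sum_congr rfl fun j _ => ?_
      simp only [hρ]
      rw [div_mul_cancel₀ _ (hNpos j).ne']
    have hlt : (1 - η) * (B k - B i) < 1 - GP P (x i + 2 * h) := by
      have h1 : B k ≤ 1 := hub _
      have h2 : GP P (x i + 2 * h) ≤ B i := hlb _
      have h3 : GP P (x i + 2 * h) < 1 := stdG_lt_one _
      nlinarith
    rw [hsum] at hlim
    obtain ⟨w, hw1, hw2⟩ := exists_between hlt
    filter_upwards [hlim.eventually_lt_const hw1, hP.eventually_le_sum_light hVP hw2]
      with n h1 h2
    exact h1.le.trans h2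
  have hsmall : ∀ᶠ n : ℕ in atTop, ∀ i ∈ range k, 0 < ρ i →
      Real.exp (-(Real.sqrt n * h)) ≤ η * ρ i := by
    rw [eventually_all_finset]
    intro i _
    rcases (hρ0 i).eq_or_lt with h0 | h0
    · exact .of_forall fun n hn => absurd h0 hn.ne
    have hs : Tendsto (fun n : ℕ => Real.sqrt n) atTop atTop :=
      Real.tendsto_sqrt_atTop.comp tendsto_natCast_atTop_atTop
    have hexp := Real.tendsto_exp_neg_atTop_nhds_zero.comp (hs.atTop_mul_const hh)
    filter_upwards [hexp.eventually_lt_const (mul_pos hη h0)] with n hn _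
    exact hn.le
  have hval : Tendsto (fun n => ∑ i ∈ range k, Real.sqrt ((1 - η) * ρ i) * m n i) atTop
      (𝓝 (∑ i ∈ range k, Real.sqrt ((1 - η) * ρ i) * N i)) :=
    tendsto_finsetSum _ fun j hj => (hmN j (mem_range.1 hj)).const_mul _
  have hvaleq : ∑ i ∈ range k, Real.sqrt ((1 - η) * ρ i) * N i =
      (1 - η) * ∑ i ∈ range k, Real.sqrt ((B (i + 1) - B i) * N i) := by
    rw [mul_sum]
    refine sum_congr rfl fun i _ => ?_
    have h1 : (1 - η) * ρ i = ((1 - η) / N i) ^ 2 * ((B (i + 1) - B i) * N i) := by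
      simp only [hρ]
      field_simp [(hNpos i).ne']
    rw [h1, Real.sqrt_mul (sq_nonneg _), Real.sqrt_sq (div_nonneg hη'.le (hNpos i).le)]
    field_simp [(hNpos i).ne']
  rw [hvaleq] at hval
  filter_upwards [hval.eventually_const_lt hc, hcond, hsmall, eventually_gt_atTop 0]
    with n h1 h2 h3 hn
  refine h1.le.trans ?_
  have hsn : 0 < Real.sqrt n := Real.sqrt_pos.2 (by exact_mod_cast hn)
  refine (hP.isProb_iid n).sum_blocks_le_FD (hQ.isProb_iid (L n)) (f := f n) (T := T n)
    (fun y hy => (hfT n y hy).1) (e := e n) (fun i => (Real.exp_pos _).le) hρ0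
    (fun i hi => h2 i (mem_range.2 hi)) ?_
  intro y hy hρy
  obtain ⟨hyk, -, hyu⟩ := hfT n y hy
  have h4 := h3 (f n y) (mem_range.2 hyk) hρy
  have hq := iid_eq_exp hQ (mem_filter.1 hy).2.1
  calc e n (f n y) ≤ Real.exp (-(Real.sqrt n * h)) * iid Q (L n) y := by
        rw [hq, ← Real.exp_add]
        refine Real.exp_le_exp.2 ?_
        simp only [hpos] at hyu
        rw [div_le_iff₀ hsn, hxs] at hyu
        linarith
    _ ≤ η * ρ (f n y) * iid Q (L n) y :=
        mul_le_mul_of_nonneg_right h4 ((hQ.isProb_iid (L n)).1 y)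
    _ = η * (ρ (f n y) * iid Q (L n) y) := mul_assoc _ _ _

/-- Cauchy-Schwarz inequality for the interval integral of `√(f g)`. -/
lemma integral_sqrt_mul_le {f g : ℝ → ℝ} (hf : Continuous f) (hg : Continuous g)
    (hf0 : ∀ t, 0 ≤ f t) (hg0 : ∀ t, 0 ≤ g t) {u v : ℝ} (huv : u ≤ v) :
    ∫ t in u..v, Real.sqrt (f t * g t) ≤
      Real.sqrt ((∫ t in u..v, f t) * ∫ t in u..v, g t) := by
  refine Real.le_sqrt_of_sq_le ?_
  set a := ∫ t in u..v, f t
  set d := ∫ t in u..v, g t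
  set c := ∫ t in u..v, Real.sqrt (f t * g t)
  have hpoly : ∀ s : ℝ, 0 ≤ a * (s * s) + (-2 * c) * s + d := by
    intro s
    have h1 : 0 ≤ ∫ t in u..v, (s * Real.sqrt (f t) - Real.sqrt (g t)) ^ 2 :=
      intervalIntegral.integral_nonneg huv fun t _ => sq_nonneg _
    have h2 : ∀ t, (s * Real.sqrt (f t) - Real.sqrt (g t)) ^ 2 =
        s * s * f t + (-2 * s) * Real.sqrt (f t * g t) + g t := by
      intro t
      rw [Real.sqrt_mul (hf0 t), sub_sq, mul_pow, Real.sq_sqrt (hf0 t), Real.sq_sqrt (hg0 t)]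
      ring
    simp only [h2] at h1
    rw [intervalIntegral.integral_add, intervalIntegral.integral_add,
      intervalIntegral.integral_const_mul, intervalIntegral.integral_const_mul] at h1
    · change 0 ≤ s * s * a + -2 * s * c + d at h1
      linarith
    all_goals exact Continuous.intervalIntegrable (by fun_prop) _ _
  have := discrim_le_zero hpoly
  rw [discrim] at this
  nlinarith

/-- The shifted integral is dominated by the sum over blocks. -/
lemma integral_le_sum_blocks {A g : ℝ → ℝ} (hA : ContDiff ℝ 1 A) (hmono : Monotone A)
    (hg : Continuous g) (hg0 : ∀ t, 0 ≤ g t) (x₀ : ℝ) {h : ℝ} (hh : 0 < h) (k : ℕ) (s : ℝ) :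
    ∫ t in x₀..(x₀ + k * h), Real.sqrt (deriv A (t + s) * g t) ≤
      ∑ i ∈ Finset.range k, Real.sqrt
        ((A (x₀ + (i + 1 : ℕ) * h + s) - A (x₀ + i * h + s)) *
          ∫ t in Set.Ioc (x₀ + i * h) (x₀ + (i + 1 : ℕ) * h), g t) := by
  have hd : Continuous (deriv A) := hA.continuous_deriv le_rfl
  have hcont : Continuous fun t => Real.sqrt (deriv A (t + s) * g t) := by fun_prop
  have hsplit := intervalIntegral.sum_integral_adjacent_intervals (μ := volume)
    (f := fun t => Real.sqrt (deriv A (t + s) * g t)) (a := fun i : ℕ => x₀ + i * h) (n := k)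
    fun i _ => hcont.intervalIntegrable _ _
  simp only [Nat.cast_zero, zero_mul, add_zero] at hsplit
  rw [← hsplit]
  refine Finset.sum_le_sum fun i _ => ?_
  have hle : x₀ + i * h ≤ x₀ + (i + 1 : ℕ) * h := by
    push_cast
    nlinarith
  refine (integral_sqrt_mul_le (f := fun t => deriv A (t + s)) (by fun_prop) hg
    (fun t => hmono.deriv_nonneg) hg0 hle).trans (le_of_eq ?_)
  rw [intervalIntegral.integral_comp_add_right (fun t => deriv A t),
    intervalIntegral.integral_deriv_eq_sub (fun t _ => (hA.differentiable (by simp)) t)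
      (hd.intervalIntegrable _ _), intervalIntegral.integral_of_le hle]

/-- The integral of `√(A' g)` over the line is approximated by discounted integrals over bounded
intervals of the shifted integrand, the shift being twice the mesh of a uniform grid. -/
lemma exists_lt_shifted_integral {A g : ℝ → ℝ} (hA : ContDiff ℝ 1 A) (hg : Continuous g)
    (hint : Integrable fun t => Real.sqrt (deriv A t * g t)) {c : ℝ}
    (hc : c < ∫ t, Real.sqrt (deriv A t * g t)) :
    ∃ (x₀ h : ℝ) (k : ℕ) (η : ℝ), 0 < h ∧ 0 < η ∧ η < 1 ∧
      c < (1 - η) * ∫ t in x₀..(x₀ + k * h), Real.sqrt (deriv A (t + 2 * h) * g t) := by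
  have hd : Continuous (deriv A) := hA.continuous_deriv le_rfl
  have h1 := intervalIntegral_tendsto_integral hint
    (tendsto_neg_atTop_atBot.comp (tendsto_natCast_atTop_atTop (R := ℝ)))
    (tendsto_natCast_atTop_atTop (R := ℝ))
  obtain ⟨R, hR, hR0⟩ := ((h1.eventually_const_lt hc).and (eventually_gt_atTop 0)).exists
  have hR0' : (0 : ℝ) < R := by exact_mod_cast hR0
  have hcont : Continuous fun s : ℝ => (1 - s) *
      ∫ t in (-(R : ℝ))..R, Real.sqrt (deriv A (t + 4 * R * s) * g t) := by
    refine (continuous_const.sub continuous_id).mul ?_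
    exact intervalIntegral.continuous_parametric_intervalIntegral_of_continuous' (by fun_prop) _ _
  have h2 : Tendsto (fun k : ℕ => (1 - 1 / ((k : ℝ) + 1)) *
      ∫ t in (-(R : ℝ))..R, Real.sqrt (deriv A (t + 4 * R * (1 / ((k : ℝ) + 1))) * g t)) atTop
      (𝓝 (∫ t in (-(R : ℝ))..R, Real.sqrt (deriv A t * g t))) := by
    have := (hcont.tendsto 0).comp tendsto_one_div_add_atTop_nhds_zero_nat
    simpa [Function.comp_def] using this
  obtain ⟨k, hk, hk0⟩ := ((h2.eventually_const_lt hR).and (eventually_gt_atTop 0)).exists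
  have hk0' : (0 : ℝ) < k := by exact_mod_cast hk0
  refine ⟨-R, 2 * R / (k + 1), k + 1, 1 / (k + 1), by positivity, by positivity, ?_, ?_⟩
  · rw [div_lt_one (by positivity)]
    linarith
  · have h3 : -(R : ℝ) + ((k + 1 : ℕ) : ℝ) * (2 * R / (k + 1)) = R := by
      push_cast
      field_simp
      ring
    have h4 : 2 * (2 * (R : ℝ) / (k + 1)) = 4 * R * (1 / ((k : ℝ) + 1)) := by ring
    rw [h3, h4]
    exact hk

end Blocks

/-- the direct part lemma. -/
theorem direct_part {X Y : Type*} [Fintype X] [Fintype Y]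
    (P : X → ℝ) (Q : Y → ℝ) (hP : IsProb P) (hQ : IsProb Q)
    (hVP : 0 < V P) (hHQ : 0 < H Q) (b : ℝ)
    (A : ℝ → ℝ) (hA : ContDiff ℝ 1 A) (hmono : Monotone A)
    (hlb : ∀ x, GP P x ≤ A x) (hub : ∀ x, A x ≤ 1) :
    (∫ x : ℝ, Real.sqrt (deriv A x * NPQ P Q b x)) ≤
      liminf (fun n : ℕ =>
        FD (iid P n) (iid Q ⌊H P / H Q * n + b * Real.sqrt n⌋₊)) atTop := by
  have hbdd : ∀ n : ℕ, FD (iid P n) (iid Q ⌊H P / H Q * n + b * Real.sqrt n⌋₊) ≤ 1 := fun n =>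
    (hP.isProb_iid n).FD_le_one (hQ.isProb_iid _)
  have hcob : IsCoboundedUnder (· ≥ ·) atTop (fun n : ℕ =>
      FD (iid P n) (iid Q ⌊H P / H Q * n + b * Real.sqrt n⌋₊)) :=
    (isBoundedUnder_of ⟨1, hbdd⟩ : IsBoundedUnder (· ≤ ·) atTop _).isCoboundedUnder_ge
  have hnonneg : 0 ≤ liminf (fun n : ℕ =>
      FD (iid P n) (iid Q ⌊H P / H Q * n + b * Real.sqrt n⌋₊)) atTop :=
    le_liminf_of_le hcob (.of_forall fun n => FD_nonneg _ _)
  by_cases hint : Integrable fun x : ℝ => Real.sqrt (deriv A x * NPQ P Q b x)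
  swap
  · rwa [integral_undef hint]
  have hVQ0 : 0 ≤ V Q := Finset.sum_nonneg fun y _ => mul_nonneg (hQ.1 y) (sq_nonneg _)
  rcases hVQ0.eq_or_lt with hVQ | hVQ
  · have h0 : ∀ x, NPQ P Q b x = 0 := fun x => by simp [NPQ, normalPDF, ← hVQ]
    simpa [h0] using hnonneg
  have hHP := H_pos_of_V_pos hP hVP
  have hcont : Continuous (NPQ P Q b) := continuous_normalPDF _ _
  have hpos : ∀ x, 0 ≤ NPQ P Q b x := fun x => (normalPDF_pos (by positivity) x).le
  refine le_of_forall_lt fun c hc => ?_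
  obtain ⟨c', hcc', hc'⟩ := exists_between hc
  obtain ⟨x₀, h, k, η, hh, hη, hη1, hlt⟩ := exists_lt_shifted_integral hA hcont hint hc'
  refine hcc'.trans_le (le_liminf_of_le hcob ?_)
  refine eventually_le_FD_of_lt_sum_blocks hP hQ hVP hVQ hHQ b hmono hlb hub x₀ hh k hη hη1 ?_
  refine hlt.trans_le (mul_le_mul_of_nonneg_left ?_ (by linarith))
  exact integral_le_sum_blocks hA hmono hcont hpos x₀ hh k (2 * h)

end RNG
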